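/- Define f(s,s) = (∫₀^∞ e^{−2s x^{2/α}}/(1+x)dx)/(s∫₀^∞ x^{2/α}e^{−2s x^{2/α}}/(1+x)dx). Then lim_{s→0⁺} f(s,s) = ∞ and lim_{s→∞} f(s,s) = 4/α. Consequently a solution s of f(s,s) = 1 exists if and only if α > 4, and when α > 4 this solution Λ''(α) is unique. -/

import Mathlib

open Real MeasureTheory Filter

noncomputable def wG (q a c t : ℝ) : ℝ := t ^ (a - 1) * Real.exp (-(2 * t)) / (c + t ^ q)

noncomputable def GG (q a c : ℝ) : ℝ := ∫ t in Set.Ioi (0 : ℝ), wG q a c t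

lemma kint (a : ℝ) (ha : 0 < a) :
    IntegrableOn (fun t : ℝ => t ^ (a - 1) * Real.exp (-(2 * t))) (Set.Ioi 0) := by
  have h := integrableOn_rpow_mul_exp_neg_mul_rpow (p := 1) (s := a - 1) (b := 2)
    (by linarith) one_pos (by norm_num)
  refine h.congr_fun (fun t _ => ?_) measurableSet_Ioi
  simp

lemma wG_meas (q a c : ℝ) : Measurable (wG q a c) := by
  unfold wG; fun_prop

lemma wG_pos (q a : ℝ) {c t : ℝ} (hc : 0 < c) (ht : 0 < t) : 0 < wG q a c t := by
  unfold wG; positivity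

lemma wG_le (q a : ℝ) {c d t : ℝ} (hd : 0 < d) (hc : d ≤ c) (ht : 0 < t) :
    wG q a c t ≤ d⁻¹ * (t ^ (a - 1) * Real.exp (-(2 * t))) := by
  unfold wG
  rw [div_eq_inv_mul]
  have : 0 < t ^ q := by positivity
  gcongr
  linarith

lemma wG_int (q a : ℝ) (ha : 0 < a) {c : ℝ} (hc : 0 < c) :
    IntegrableOn (wG q a c) (Set.Ioi 0) := by
  refine Integrable.mono' ((kint a ha).const_mul c⁻¹) (wG_meas q a c).aestronglyMeasurable ?_
  filter_upwards [ae_restrict_mem measurableSet_Ioi] with t ht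
  rw [Real.norm_of_nonneg (wG_pos q a hc ht).le]
  exact wG_le q a hc le_rfl ht

lemma GG_pos (q a : ℝ) (ha : 0 < a) {c : ℝ} (hc : 0 < c) : 0 < GG q a c := by
  unfold GG
  rw [setIntegral_pos_iff_support_of_nonneg_ae]
  · have : Set.Ioi (0:ℝ) ⊆ Function.support (wG q a c) ∩ Set.Ioi 0 :=
      fun t ht => ⟨(wG_pos q a hc ht).ne', ht⟩
    refine lt_of_lt_of_le ?_ (measure_mono this)
    simp
  · filter_upwards [ae_restrict_mem measurableSet_Ioi] with t ht
    exact (wG_pos q a hc ht).le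
  · exact wG_int q a ha hc

lemma GG_cont (q a : ℝ) (ha : 0 < a) : ContinuousOn (GG q a) (Set.Ioi 0) := by
  intro c hc
  have hc : 0 < c := hc
  refine ContinuousAt.continuousWithinAt ?_
  unfold GG
  refine continuousAt_of_dominated (bound := fun t => (c/2)⁻¹ * (t ^ (a - 1) * Real.exp (-(2 * t))))
    ?_ ?_ ((kint a ha).const_mul _) ?_
  · exact Eventually.of_forall fun d => (wG_meas q a d).aestronglyMeasurable
  · filter_upwards [Ioi_mem_nhds (show c/2 < c by linarith)] with d hd
    have hd : c/2 < d := hd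
    filter_upwards [ae_restrict_mem measurableSet_Ioi] with t ht
    rw [Real.norm_of_nonneg (wG_pos q a (by linarith) ht).le]
    exact wG_le q a (by linarith) hd.le ht
  · filter_upwards [ae_restrict_mem measurableSet_Ioi] with t ht
    have ht : 0 < t := ht
    have : 0 < t ^ q := by positivity
    unfold wG
    exact ContinuousAt.div (by fun_prop) (by fun_prop) (by positivity)

lemma GG_top (q a : ℝ) (ha : 0 < a) :
    Tendsto (fun c => c * GG q a c) atTop (nhds ((1/2) ^ a * Real.Gamma a)) := by
  rw [← Real.integral_rpow_mul_exp_neg_mul_Ioi ha (by norm_num : (0:ℝ) < 2)]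
  unfold GG
  simp_rw [← integral_const_mul]
  refine tendsto_integral_filter_of_dominated_convergence
    (bound := fun t => (t ^ (a - 1) * Real.exp (-(2 * t)))) ?_ ?_ (kint a ha) ?_
  · exact Eventually.of_forall fun d => ((wG_meas q a d).const_mul d).aestronglyMeasurable
  · filter_upwards [eventually_gt_atTop 0] with d hd
    filter_upwards [ae_restrict_mem measurableSet_Ioi] with t ht
    rw [Real.norm_of_nonneg (mul_nonneg hd.le (wG_pos q a hd ht).le)]
    have := mul_le_mul_of_nonneg_left (wG_le q a hd le_rfl ht) hd.le
    rwa [mul_inv_cancel_left₀ hd.ne'] at this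
  · filter_upwards with t
    have h1 : Tendsto (fun c : ℝ => 1 - t ^ q / (c + t ^ q)) atTop (nhds (1 - 0)) :=
      tendsto_const_nhds.sub
        (tendsto_const_nhds.div_atTop (tendsto_atTop_add_const_right _ _ tendsto_id))
    have h2 := h1.const_mul (t ^ (a - 1) * Real.exp (-(2 * t)))
    rw [sub_zero, mul_one] at h2
    refine h2.congr' ?_
    filter_upwards [eventually_gt_atTop (-(t^q))] with c hc
    have : c + t ^ q ≠ 0 := by linarith
    unfold wG
    field_simp
    ring

lemma wG_succ (q c : ℝ) {t : ℝ} (ht : 0 < t) : wG q (q+1) c t = t * wG q q c t := by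
  unfold wG
  have : t ^ (q + 1 - 1) = t * t ^ (q-1) := by
    rw [mul_comm, ← Real.rpow_add_one ht.ne']; congr 1; ring
  rw [this]; ring

lemma GG_succ_le (q : ℝ) (hq : 0 < q) {c : ℝ} (hc : 0 < c) :
    GG q (q+1) c ≤ ∫ t in Set.Ioi (0:ℝ), t ^ ((1:ℝ) - 1) * Real.exp (-(2 * t)) := by
  unfold GG
  refine setIntegral_mono_on (wG_int q (q+1) (by linarith) hc) (kint 1 one_pos) measurableSet_Ioi ?_
  intro t ht
  have ht : 0 < t := ht
  have : 0 < t ^ q := by positivity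
  unfold wG
  rw [div_le_iff₀ (by linarith), sub_self, Real.rpow_zero, add_sub_cancel_right, one_mul, mul_comm]
  gcongr
  linarith

lemma GG_zero (q : ℝ) (hq : 1 < q) :
    Tendsto (GG q q) (nhdsWithin 0 (Set.Ioi 0)) atTop := by
  have key : ∀ c : ℝ, 0 < c → Real.exp (-2) * (q⁻¹ * (-Real.log c)) ≤ GG q q c := by
    intro c hc
    have hder : ∀ t ∈ Set.uIcc (0:ℝ) 1, HasDerivAt (fun t : ℝ => q⁻¹ * Real.log (c + t ^ q))
        (t ^ (q - 1) / (c + t ^ q)) t := by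
      intro t ht
      rw [Set.uIcc_of_le zero_le_one] at ht
      have h0 : 0 ≤ t ^ q := Real.rpow_nonneg ht.1 _
      have h1 := ((Real.hasDerivAt_rpow_const (x := t) (p := q) (Or.inr hq.le)).const_add c).log
        (by positivity)
      have h2 := h1.const_mul q⁻¹
      have hq0 : q ≠ 0 := by linarith
      rw [mul_div_assoc, inv_mul_cancel_left₀ hq0] at h2
      exact h2
    have hcont : ContinuousOn (fun t : ℝ => t ^ (q - 1) / (c + t ^ q)) (Set.uIcc 0 1) := by
      rw [Set.uIcc_of_le zero_le_one]
      refine ContinuousOn.div ?_ ?_ ?_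
      · exact (Real.continuous_rpow_const (by linarith)).continuousOn
      · exact (continuous_const.add (Real.continuous_rpow_const (by linarith))).continuousOn
      · intro t ht
        have h0 : 0 ≤ t ^ q := Real.rpow_nonneg ht.1 _
        positivity
    have hint := hcont.intervalIntegrable (μ := volume)
    have hI := intervalIntegral.integral_eq_sub_of_hasDerivAt hder hint
    rw [intervalIntegral.integral_of_le zero_le_one] at hI
    have hint' : IntegrableOn (fun t : ℝ => t ^ (q - 1) / (c + t ^ q)) (Set.Ioc 0 1) :=
      (intervalIntegrable_iff_integrableOn_Ioc_of_le zero_le_one).1 hint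
    have h1 : Real.exp (-2) * (∫ t in Set.Ioc (0:ℝ) 1, t ^ (q - 1) / (c + t ^ q)) ≤
        ∫ t in Set.Ioc (0:ℝ) 1, wG q q c t := by
      rw [← integral_const_mul]
      refine setIntegral_mono_on (hint'.const_mul _)
        ((wG_int q q (by linarith) hc).mono_set Set.Ioc_subset_Ioi_self) measurableSet_Ioc ?_
      intro t ht
      have ht0 : 0 < t := ht.1
      have : 0 < t ^ q := by positivity
      have h2 : Real.exp (-2) ≤ Real.exp (-(2*t)) := Real.exp_le_exp.2 (by linarith [ht.2])
      unfold wG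
      rw [← mul_div_assoc, mul_comm]
      gcongr
    have h3 : ∫ t in Set.Ioc (0:ℝ) 1, wG q q c t ≤ GG q q c := by
      unfold GG
      refine setIntegral_mono_set (wG_int q q (by linarith) hc) ?_
        (Set.Ioc_subset_Ioi_self).eventuallyLE
      filter_upwards [ae_restrict_mem measurableSet_Ioi] with t ht
      exact (wG_pos q q hc ht).le
    refine le_trans ?_ (h1.trans h3)
    rw [hI, Real.zero_rpow (by linarith), Real.one_rpow, add_zero]
    have : 0 ≤ Real.log (c+1) := Real.log_nonneg (by linarith)
    have hq' : 0 < q⁻¹ := by positivity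
    gcongr
    nlinarith
  refine tendsto_atTop_mono' _ (f₁ := fun c => Real.exp (-2) * (q⁻¹ * (-Real.log c))) ?_ ?_
  · filter_upwards [self_mem_nhdsWithin] with c hc using key c hc
  · exact ((tendsto_neg_atBot_atTop.comp Real.tendsto_log_nhdsGT_zero).const_mul_atTop
      (by positivity)).const_mul_atTop (by positivity)

noncomputable def FF (q c : ℝ) : ℝ := GG q q c / GG q (q+1) c

lemma FF_anti (q : ℝ) (hq : 1 < q) : StrictAntiOn (FF q) (Set.Ioi 0) := by
  intro c hc d hd hcd
  have hc : 0 < c := hc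
  have hd : 0 < d := hd
  have hA := GG_pos q q (by linarith) hc
  have hB := GG_pos q (q+1) (by linarith) hc
  have hA' := GG_pos q q (by linarith) hd
  have hB' := GG_pos q (q+1) (by linarith) hd
  have iA := wG_int q q (by linarith) hc
  have iB := wG_int q (q+1) (by linarith) hc
  have iA' := wG_int q q (by linarith) hd
  have iB' := wG_int q (q+1) (by linarith) hd
  unfold FF
  set m := GG q (q+1) c / GG q q c with hm
  have hm0 : 0 < m := by positivity
  set r := (c + m ^ q) / (d + m ^ q) with hr
  have hpt : ∀ t : ℝ, 0 < t → t ≠ m →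
      0 < (wG q (q+1) d t - m * wG q q d t) - r * (wG q (q+1) c t - m * wG q q c t) := by
    intro t ht htm
    rw [wG_succ q c ht, wG_succ q d ht]
    have e : wG q q d t = (c + t ^ q) / (d + t ^ q) * wG q q c t := by
      unfold wG
      have : 0 < t ^ q := by positivity
      field_simp
    rw [e]
    have hw := wG_pos q q hc ht
    have htq : 0 < t ^ q := by positivity
    have hmq : 0 < m ^ q := by positivity
    have e2 : (c + t ^ q) / (d + t ^ q) - r = (d - c) * (t ^ q - m ^ q) /
        ((d + t ^ q) * (d + m ^ q)) := by
      rw [hr]; field_simp; ring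
    have e3 : 0 < (t - m) * (t ^ q - m ^ q) := by
      rcases lt_or_gt_of_ne htm with h | h
      · have := Real.rpow_lt_rpow ht.le h (by linarith : 0 < q)
        exact mul_pos_of_neg_of_neg (by linarith) (by linarith)
      · have := Real.rpow_lt_rpow hm0.le h (by linarith : 0 < q)
        exact mul_pos (by linarith) (by linarith)
    have e4 : 0 < (t - m) * ((c + t ^ q) / (d + t ^ q) - r) := by
      rw [e2]
      have : 0 < d - c := by linarith
      have e5 : (t - m) * ((d - c) * (t ^ q - m ^ q) / ((d + t ^ q) * (d + m ^ q))) =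
        (d - c) * ((t - m) * (t ^ q - m ^ q)) / ((d + t ^ q) * (d + m ^ q)) := by ring
      rw [e5]; positivity
    have := mul_pos e4 hw
    linarith
  have hI : IntegrableOn (fun t => (wG q (q+1) d t - m * wG q q d t) -
      r * (wG q (q+1) c t - m * wG q q c t)) (Set.Ioi 0) :=
    (iB'.sub (iA'.const_mul m)).sub ((iB.sub (iA.const_mul m)).const_mul r)
  have hpos : 0 < ∫ t in Set.Ioi (0:ℝ), ((wG q (q+1) d t - m * wG q q d t) -
      r * (wG q (q+1) c t - m * wG q q c t)) := by
    rw [setIntegral_pos_iff_support_of_nonneg_ae _ hI]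
    · refine lt_of_lt_of_le ?_ (measure_mono (s := Set.Ioi m)
        fun t ht => ⟨(hpt t (hm0.trans ht) (ne_of_gt ht)).ne', hm0.trans ht⟩)
      simp
    · have : ∀ᵐ t : ℝ ∂(volume.restrict (Set.Ioi 0)), t ≠ m :=
        ae_restrict_of_ae (Measure.ae_ne volume m)
      filter_upwards [ae_restrict_mem measurableSet_Ioi, this] with t ht h
      exact (hpt t ht h).le
  have hval : ∫ t in Set.Ioi (0:ℝ), ((wG q (q+1) d t - m * wG q q d t) -
      r * (wG q (q+1) c t - m * wG q q c t)) =
      (GG q (q+1) d - m * GG q q d) - r * (GG q (q+1) c - m * GG q q c) := by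
    have j1 : IntegrableOn (fun t => wG q (q+1) d t - m * wG q q d t) (Set.Ioi 0) :=
      iB'.sub (iA'.const_mul m)
    have j2 : IntegrableOn (fun t => r * (wG q (q+1) c t - m * wG q q c t)) (Set.Ioi 0) :=
      (iB.sub (iA.const_mul m)).const_mul r
    unfold GG
    rw [integral_sub j1 j2,
      integral_const_mul, integral_sub iB' (iA'.const_mul m), integral_sub iB (iA.const_mul m),
      integral_const_mul, integral_const_mul]
  have hz : GG q (q+1) c - m * GG q q c = 0 := by
    rw [hm]; field_simp; ring
  rw [hval, hz, mul_zero, sub_zero, hm] at hpos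
  rw [div_lt_div_iff₀ hB' hB]
  have := mul_pos hpos hA
  have e : (GG q (q+1) d - GG q (q+1) c / GG q q c * GG q q d) * GG q q c =
    GG q (q+1) d * GG q q c - GG q (q+1) c * GG q q d := by field_simp
  rw [e] at this
  linarith

lemma FF_cont (q : ℝ) (hq : 1 < q) : ContinuousOn (FF q) (Set.Ioi 0) :=
  (GG_cont q q (by linarith)).div (GG_cont q (q+1) (by linarith))
    fun _ hc => (GG_pos q (q+1) (by linarith) hc).ne'

lemma FF_zero (q : ℝ) (hq : 1 < q) : Tendsto (FF q) (nhdsWithin 0 (Set.Ioi 0)) atTop := by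
  set K := ∫ t in Set.Ioi (0:ℝ), t ^ ((1:ℝ) - 1) * Real.exp (-(2 * t)) with hK
  have hK0 : 0 < K := (GG_pos q (q+1) (by linarith) one_pos).trans_le
    (GG_succ_le q (by linarith) one_pos)
  refine tendsto_atTop_mono' _ ?_ ((GG_zero q hq).atTop_div_const hK0)
  filter_upwards [self_mem_nhdsWithin] with c hc
  have hA := GG_pos q q (by linarith) hc
  have hB := GG_pos q (q+1) (by linarith) hc
  have := GG_succ_le q (by linarith) hc
  unfold FF
  gcongr

lemma FF_top (q : ℝ) (hq : 1 < q) : Tendsto (FF q) atTop (nhds (2 / q)) := by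
  have hG : 0 < Real.Gamma q := Real.Gamma_pos_of_pos (by linarith)
  have hG' : 0 < Real.Gamma (q+1) := Real.Gamma_pos_of_pos (by linarith)
  have h := (GG_top q q (by linarith)).div (GG_top q (q+1) (by linarith)) (by positivity)
  have e : (1/2:ℝ) ^ q * Real.Gamma q / ((1/2) ^ (q+1) * Real.Gamma (q+1)) = 2 / q := by
    rw [Real.Gamma_add_one (by linarith), Real.rpow_add_one (by norm_num)]
    field_simp
  rw [e] at h
  refine h.congr' ?_
  filter_upwards [eventually_gt_atTop 0] with c hc
  unfold FF
  simp only [Pi.div_apply]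
  rw [mul_div_mul_left _ _ hc.ne']

lemma sub_N (q s : ℝ) (hq : 1 < q) (hs : 0 < s) :
    ∫ x in Set.Ioi (0 : ℝ), Real.exp (-(2 * s * x ^ q⁻¹)) / (1 + x) = q * GG q q (s ^ q) := by
  rw [← integral_comp_rpow_Ioi _ (show q ≠ 0 by linarith)]
  have h := integral_comp_mul_left_Ioi (wG q q (s ^ q)) 0 hs
  rw [mul_zero, smul_eq_mul] at h
  have h2 : GG q q (s^q) = s * ∫ x in Set.Ioi (0:ℝ), wG q q (s^q) (s * x) := by
    rw [h, mul_inv_cancel_left₀ hs.ne']; rfl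
  rw [h2, ← integral_const_mul, ← integral_const_mul]
  refine setIntegral_congr_fun measurableSet_Ioi fun x hx => ?_
  have hx : 0 < x := hx
  simp only [smul_eq_mul, wG]
  rw [abs_of_pos (by linarith : 0 < q), Real.rpow_rpow_inv hx.le (by linarith),
    Real.mul_rpow hs.le hx.le, Real.mul_rpow hs.le hx.le, Real.rpow_sub_one hs.ne']
  have : 0 < x ^ q := by positivity
  have : 0 < s ^ q := by positivity
  rw [← mul_assoc 2 s x]
  field_simp

lemma sub_D (q s : ℝ) (hq : 1 < q) (hs : 0 < s) :
    s * ∫ x in Set.Ioi (0 : ℝ), x ^ q⁻¹ * Real.exp (-(2 * s * x ^ q⁻¹)) / (1 + x)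
      = q * GG q (q+1) (s ^ q) := by
  rw [← integral_comp_rpow_Ioi _ (show q ≠ 0 by linarith)]
  have h := integral_comp_mul_left_Ioi (wG q (q+1) (s ^ q)) 0 hs
  rw [mul_zero, smul_eq_mul] at h
  have h2 : GG q (q+1) (s^q) = s * ∫ x in Set.Ioi (0:ℝ), wG q (q+1) (s^q) (s * x) := by
    rw [h, mul_inv_cancel_left₀ hs.ne']; rfl
  rw [h2, ← integral_const_mul, ← integral_const_mul, ← integral_const_mul]
  refine setIntegral_congr_fun measurableSet_Ioi fun x hx => ?_
  have hx : 0 < x := hx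
  simp only [smul_eq_mul, wG_succ q _ (mul_pos hs hx)]
  simp only [wG]
  rw [abs_of_pos (by linarith : 0 < q), Real.rpow_rpow_inv hx.le (by linarith),
    Real.mul_rpow hs.le hx.le, Real.mul_rpow hs.le hx.le, Real.rpow_sub_one hs.ne']
  have : 0 < x ^ q := by positivity
  have : 0 < s ^ q := by positivity
  rw [← mul_assoc 2 s x]
  field_simp

lemma f_eq (α s : ℝ) (hα : 2 < α) (hs : 0 < s) :
    (∫ x in Set.Ioi (0 : ℝ), Real.exp (-(2 * s * x ^ (2 / α))) / (1 + x)) /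
        (s * ∫ x in Set.Ioi (0 : ℝ),
          x ^ (2 / α) * Real.exp (-(2 * s * x ^ (2 / α))) / (1 + x)) = FF (α/2) (s ^ (α/2)) := by
  have e : 2 / α = (α/2)⁻¹ := by rw [inv_div]
  rw [e, sub_N _ _ (by linarith) hs, sub_D _ _ (by linarith) hs,
    mul_div_mul_left _ _ (by linarith)]
  rfl

lemma FF_gt (q : ℝ) (hq : 1 < q) {c : ℝ} (hc : 0 < c) : 2 / q < FF q c := by
  have h1 : FF q (c+1) < FF q c :=
    FF_anti q hq hc (show (0:ℝ) < c + 1 by linarith) (by linarith)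
  refine lt_of_le_of_lt ?_ h1
  refine le_of_tendsto (FF_top q hq) ?_
  filter_upwards [eventually_ge_atTop (c+1)] with d hd
  exact (FF_anti q hq).antitoneOn (show (0:ℝ) < c + 1 by linarith)
    (show (0:ℝ) < d by linarith) hd

lemma FF_ex (q : ℝ) (hq : 2 < q) : ∃ c : ℝ, 0 < c ∧ FF q c = 1 := by
  obtain ⟨a, ha, ha0⟩ := (((FF_zero q (by linarith)).eventually (eventually_ge_atTop 1)).and
    self_mem_nhdsWithin).exists
  have h2 : 2 / q < 1 := by rw [div_lt_one (by linarith)]; exact hq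
  obtain ⟨b, hb, hb0⟩ := (((FF_top q (by linarith)).eventually (gt_mem_nhds h2)).and
    (eventually_gt_atTop 0)).exists
  obtain ⟨c, hc, h⟩ := isPreconnected_Ioi.intermediate_value (show b ∈ Set.Ioi 0 from hb0) ha0
    (FF_cont q (by linarith)) ⟨hb.le, ha⟩
  exact ⟨c, hc, h⟩

theorem f_diag_limits_and_Lambda_doubleprime (α : ℝ) (hα : 2 < α) :
    (Tendsto (fun s : ℝ =>
        (∫ x in Set.Ioi (0 : ℝ), Real.exp (-(2 * s * x ^ (2 / α))) / (1 + x)) /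
        (s * ∫ x in Set.Ioi (0 : ℝ),
          x ^ (2 / α) * Real.exp (-(2 * s * x ^ (2 / α))) / (1 + x)))
      (nhdsWithin 0 (Set.Ioi 0)) atTop) ∧
    (Tendsto (fun s : ℝ =>
        (∫ x in Set.Ioi (0 : ℝ), Real.exp (-(2 * s * x ^ (2 / α))) / (1 + x)) /
        (s * ∫ x in Set.Ioi (0 : ℝ),
          x ^ (2 / α) * Real.exp (-(2 * s * x ^ (2 / α))) / (1 + x)))
      atTop (nhds (4 / α))) ∧
    ((∃ s : ℝ, 0 < s ∧
        (∫ x in Set.Ioi (0 : ℝ), Real.exp (-(2 * s * x ^ (2 / α))) / (1 + x)) /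
        (s * ∫ x in Set.Ioi (0 : ℝ),
          x ^ (2 / α) * Real.exp (-(2 * s * x ^ (2 / α))) / (1 + x)) = 1) ↔ 4 < α) ∧
    (4 < α → ∃! s : ℝ, 0 < s ∧
        (∫ x in Set.Ioi (0 : ℝ), Real.exp (-(2 * s * x ^ (2 / α))) / (1 + x)) /
        (s * ∫ x in Set.Ioi (0 : ℝ),
          x ^ (2 / α) * Real.exp (-(2 * s * x ^ (2 / α))) / (1 + x)) = 1) := by
  have hq : 1 < α / 2 := by linarith
  have e4 : 4 / α = 2 / (α / 2) := by field_simp; norm_num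
  have hex : 4 < α → ∃ s : ℝ, 0 < s ∧
        (∫ x in Set.Ioi (0 : ℝ), Real.exp (-(2 * s * x ^ (2 / α))) / (1 + x)) /
        (s * ∫ x in Set.Ioi (0 : ℝ),
          x ^ (2 / α) * Real.exp (-(2 * s * x ^ (2 / α))) / (1 + x)) = 1 := by
    intro h
    obtain ⟨c, hc, hF⟩ := FF_ex (α / 2) (by linarith)
    have hs : 0 < c ^ (α / 2)⁻¹ := by positivity
    refine ⟨c ^ (α / 2)⁻¹, hs, ?_⟩
    rw [f_eq α _ hα hs, Real.rpow_inv_rpow hc.le (by linarith), hF]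
  refine ⟨?_, ?_, ⟨?_, hex⟩, ?_⟩
  · have h0 : Tendsto (fun s : ℝ => s ^ (α / 2)) (nhdsWithin 0 (Set.Ioi 0))
        (nhdsWithin 0 (Set.Ioi 0)) := by
      refine tendsto_nhdsWithin_iff.2 ⟨?_, ?_⟩
      · have := (Real.continuous_rpow_const (q := α / 2) (by linarith)).tendsto 0
        rw [Real.zero_rpow (by linarith)] at this
        exact this.mono_left nhdsWithin_le_nhds
      · filter_upwards [self_mem_nhdsWithin] with s hs
        exact Real.rpow_pos_of_pos hs _
    refine ((FF_zero _ hq).comp h0).congr' ?_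
    filter_upwards [self_mem_nhdsWithin] with s hs
    exact (f_eq α s hα hs).symm
  · rw [e4]
    refine ((FF_top _ hq).comp (tendsto_rpow_atTop (by linarith : 0 < α / 2))).congr' ?_
    filter_upwards [eventually_gt_atTop 0] with s hs
    exact (f_eq α s hα hs).symm
  · rintro ⟨s, hs, h⟩
    rw [f_eq α s hα hs] at h
    have := FF_gt _ hq (Real.rpow_pos_of_pos hs (α / 2))
    rw [h, ← e4, div_lt_one (by linarith)] at this
    exact this
  · intro h
    obtain ⟨s, hs, hF⟩ := hex h
    refine ⟨s, ⟨hs, hF⟩, ?_⟩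
    rintro t ⟨ht, hF'⟩
    rw [f_eq α s hα hs] at hF
    rw [f_eq α t hα ht] at hF'
    have := (FF_anti _ hq).injOn (Real.rpow_pos_of_pos ht (α / 2))
      (Real.rpow_pos_of_pos hs (α / 2)) (hF'.trans hF.symm)
    exact (Real.rpow_left_inj ht.le hs.le (by linarith)).1 this
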